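/- Let φ : ℝⁿ × (0,∞) → (0,∞) satisfy the doubling condition (D), let Φ*(x,r) = ∫₁^{max(2,|x|,r)} φ(0,t)/t dt and Φ**(x,r) = ∫_r^{max(2,|x|,r)} φ(x,t)/t dt, and set ψ = φ·(Φ* + Φ**). Let 1 ≤ p₂ < p₁ < ∞ and p₄ ≥ p₁p₂/(p₁ − p₂). Then every g ∈ 𝓛𝓝_{p₄,φ}(ℝⁿ) is a pointwise multiplier from 𝓛𝓝_{p₁,φ}(ℝⁿ) to 𝓛𝓝_{p₂,ψ}(ℝⁿ), and there is a constant C such that ‖fg‖_{𝓛𝓝_{p₂,ψ}} ≤ C‖f‖_{𝓛𝓝_{p₁,φ}} ‖g‖_{𝓛𝓝_{p₄,φ}} for all f ∈ 𝓛𝓝_{p₁,φ}(ℝⁿ) and g ∈ 𝓛𝓝_{p₄,φ}(ℝⁿ). -/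

import Mathlib

open MeasureTheory Metric Filter
open scoped ENNReal NNReal

noncomputable section

/-- Average of `f` over the ball `B(x,r)`. -/
def ballAvg {n : ℕ} (f : EuclideanSpace ℝ (Fin n) → ℝ) (x : EuclideanSpace ℝ (Fin n))
    (r : ℝ) : ℝ :=
  (volume (ball x r)).toReal⁻¹ * ∫ y in ball x r, f y

/-- Campanato seminorm with variable growth function `φ`. -/
def campSemi {n : ℕ} (p : ℝ) (φ : EuclideanSpace ℝ (Fin n) → ℝ → ℝ)
    (f : EuclideanSpace ℝ (Fin n) → ℝ) : ℝ≥0∞ :=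
  ⨆ (x : EuclideanSpace ℝ (Fin n)) (r : ℝ) (_ : 0 < r),
    ENNReal.ofReal ((φ x r)⁻¹ *
      ((volume (ball x r)).toReal⁻¹ * ∫ y in ball x r, |f y - ballAvg f x r| ^ p) ^ (1 / p))

/-- Campanato norm: seminorm plus `|f_{B(0,1)}|`. -/
def campNorm {n : ℕ} (p : ℝ) (φ : EuclideanSpace ℝ (Fin n) → ℝ → ℝ)
    (f : EuclideanSpace ℝ (Fin n) → ℝ) : ℝ≥0∞ :=
  campSemi p φ f + ENNReal.ofReal |ballAvg f 0 1|

/-- Morrey norm with variable growth function `φ`. -/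
def morreyNorm {n : ℕ} (p : ℝ) (φ : EuclideanSpace ℝ (Fin n) → ℝ → ℝ)
    (f : EuclideanSpace ℝ (Fin n) → ℝ) : ℝ≥0∞ :=
  ⨆ (x : EuclideanSpace ℝ (Fin n)) (r : ℝ) (_ : 0 < r),
    ENNReal.ofReal ((φ x r)⁻¹ *
      ((volume (ball x r)).toReal⁻¹ * ∫ y in ball x r, |f y| ^ p) ^ (1 / p))

/-- Hölder seminorm with variable growth function `φ`. -/
def holderSemi {n : ℕ} (φ : EuclideanSpace ℝ (Fin n) → ℝ → ℝ)
    (f : EuclideanSpace ℝ (Fin n) → ℝ) : ℝ≥0∞ :=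
  ⨆ (x : EuclideanSpace ℝ (Fin n)) (y : EuclideanSpace ℝ (Fin n)) (_ : x ≠ y),
    ENNReal.ofReal (2 * |f x - f y| / (φ x (dist x y) + φ y (dist x y)))

/-- The doubling condition (D) with constant `A`. -/
def DoublingWith {n : ℕ} (A : ℝ) (φ : EuclideanSpace ℝ (Fin n) → ℝ → ℝ) : Prop :=
  ∀ (x : EuclideanSpace ℝ (Fin n)) (r s : ℝ), 0 < r → 0 < s →
    1 / 2 ≤ s / r → s / r ≤ 2 → A⁻¹ ≤ φ x s / φ x r ∧ φ x s / φ x r ≤ A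

/-- The doubling condition (D). -/
def Doubling {n : ℕ} (φ : EuclideanSpace ℝ (Fin n) → ℝ → ℝ) : Prop :=
  ∃ A > 0, DoublingWith A φ

/-- The nearness condition (N). -/
def Nearness {n : ℕ} (φ : EuclideanSpace ℝ (Fin n) → ℝ → ℝ) : Prop :=
  ∃ A > 0, ∀ (x y : EuclideanSpace ℝ (Fin n)) (r : ℝ), 0 < r → dist x y ≤ r →
    A⁻¹ ≤ φ x r / φ y r ∧ φ x r / φ y r ≤ A

/-- The almost increasing condition (I). -/
def AlmostIncreasing {n : ℕ} (φ : EuclideanSpace ℝ (Fin n) → ℝ → ℝ) : Prop :=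
  ∃ A > 0, ∀ (x : EuclideanSpace ℝ (Fin n)) (r s : ℝ), 0 < r → r < s → φ x r ≤ A * φ x s

/-- Positivity of the variable growth function. -/
def GrowthPos {n : ℕ} (φ : EuclideanSpace ℝ (Fin n) → ℝ → ℝ) : Prop :=
  ∀ (x : EuclideanSpace ℝ (Fin n)) (r : ℝ), 0 < r → 0 < φ x r

/-- `f ∈ L^p_loc(ℝⁿ)` (in particular `f ∈ L¹_loc`). -/
def MemLpLoc {n : ℕ} (p : ℝ) (f : EuclideanSpace ℝ (Fin n) → ℝ) : Prop :=
  LocallyIntegrable f volume ∧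
    ∀ (x : EuclideanSpace ℝ (Fin n)) (r : ℝ), 0 < r →
      IntegrableOn (fun y => |f y| ^ p) (ball x r) volume


/-- `Φ*(x,r) = ∫₁^{max(2,|x|,r)} φ(0,t)/t dt`. -/
def PhiStar {n : ℕ} (φ : EuclideanSpace ℝ (Fin n) → ℝ → ℝ)
    (x : EuclideanSpace ℝ (Fin n)) (r : ℝ) : ℝ :=
  ∫ t in (1 : ℝ)..(max 2 (max ‖x‖ r)), φ 0 t / t

/-- `Φ**(x,r) = ∫_r^{max(2,|x|,r)} φ(x,t)/t dt`. -/
def PhiStarStar {n : ℕ} (φ : EuclideanSpace ℝ (Fin n) → ℝ → ℝ)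
    (x : EuclideanSpace ℝ (Fin n)) (r : ℝ) : ℝ :=
  ∫ t in r..(max 2 (max ‖x‖ r)), φ x t / t

/-- normalized measure on a ball -/
def muB {n : ℕ} (x : EuclideanSpace ℝ (Fin n)) (r : ℝ) : Measure (EuclideanSpace ℝ (Fin n)) :=
  (volume (ball x r))⁻¹ • volume.restrict (ball x r)

lemma vol_pos {n : ℕ} (x : EuclideanSpace ℝ (Fin n)) {r : ℝ} (hr : 0 < r) :
    volume (ball x r) ≠ 0 := (measure_ball_pos volume x hr).ne'

lemma vol_top {n : ℕ} (x : EuclideanSpace ℝ (Fin n)) (r : ℝ) :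
    volume (ball x r) ≠ ⊤ := measure_ball_lt_top.ne

lemma muB_prob {n : ℕ} (x : EuclideanSpace ℝ (Fin n)) {r : ℝ} (hr : 0 < r) :
    IsProbabilityMeasure (muB x r) :=
  ProbabilityTheory.cond_isProbabilityMeasure_of_finite (vol_pos x hr) (vol_top x r)

lemma ballAvg_eq {n : ℕ} (f : EuclideanSpace ℝ (Fin n) → ℝ) (x : EuclideanSpace ℝ (Fin n))
    (r : ℝ) : ballAvg f x r = ∫ y, f y ∂(muB x r) := by
  simp [ballAvg, muB, integral_smul_measure]

/-- normalized Lp norm on a ball -/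
def NB {n : ℕ} (p : ℝ) (h : EuclideanSpace ℝ (Fin n) → ℝ) (x : EuclideanSpace ℝ (Fin n))
    (r : ℝ) : ℝ := (eLpNorm h (ENNReal.ofReal p) (muB x r)).toReal

lemma NB_nonneg {n : ℕ} (p : ℝ) (h : EuclideanSpace ℝ (Fin n) → ℝ)
    (x : EuclideanSpace ℝ (Fin n)) (r : ℝ) : 0 ≤ NB p h x r := ENNReal.toReal_nonneg

/-- local Lp membership -/
def ML {n : ℕ} (p : ℝ) (h : EuclideanSpace ℝ (Fin n) → ℝ) : Prop :=
  ∀ (x : EuclideanSpace ℝ (Fin n)) (r : ℝ), 0 < r → MemLp h (ENNReal.ofReal p) (muB x r)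

lemma ML_of {n : ℕ} {p : ℝ} (hp : 1 ≤ p) {f : EuclideanSpace ℝ (Fin n) → ℝ}
    (hf : MemLpLoc p f) : ML p f := by
  intro x r hr
  have h1 : AEStronglyMeasurable f volume := hf.1.aestronglyMeasurable
  have h2 : MemLp f (ENNReal.ofReal p) (volume.restrict (ball x r)) := by
    rw [← integrable_norm_rpow_iff h1.restrict (by simp; linarith) (by simp)]
    rw [ENNReal.toReal_ofReal (by linarith)]
    exact hf.2 x r hr
  exact h2.smul_measure (ENNReal.inv_ne_top.2 (vol_pos x hr))

lemma ML.sub_const {n : ℕ} {p : ℝ} {f : EuclideanSpace ℝ (Fin n) → ℝ} (hf : ML p f) (c : ℝ) :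
    ML p (fun y => f y - c) := by
  intro x r hr
  have := muB_prob x hr
  exact (hf x r hr).sub (memLp_const c)

lemma ML.mono {n : ℕ} {p q : ℝ} {f : EuclideanSpace ℝ (Fin n) → ℝ} (hf : ML q f) (h : p ≤ q) :
    ML p f := by
  intro x r hr
  have := muB_prob x hr
  exact (hf x r hr).mono_exponent (ENNReal.ofReal_le_ofReal h)

lemma NB_mono {n : ℕ} {p q : ℝ} {f : EuclideanSpace ℝ (Fin n) → ℝ} (hf : ML q f) (h : p ≤ q)
    (x : EuclideanSpace ℝ (Fin n)) {r : ℝ} (hr : 0 < r) : NB p f x r ≤ NB q f x r := by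
  have := muB_prob x hr
  exact ENNReal.toReal_mono (hf x r hr).eLpNorm_ne_top
    (eLpNorm_le_eLpNorm_of_exponent_le (ENNReal.ofReal_le_ofReal h) (hf x r hr).1)

lemma NB_add {n : ℕ} {p : ℝ} (hp : 1 ≤ p) {f g : EuclideanSpace ℝ (Fin n) → ℝ} (hf : ML p f)
    (hg : ML p g) (x : EuclideanSpace ℝ (Fin n)) {r : ℝ} (hr : 0 < r) :
    NB p (fun y => f y + g y) x r ≤ NB p f x r + NB p g x r := by
  unfold NB
  rw [← ENNReal.toReal_add (hf x r hr).eLpNorm_ne_top (hg x r hr).eLpNorm_ne_top]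
  refine ENNReal.toReal_mono (ENNReal.add_ne_top.2
    ⟨(hf x r hr).eLpNorm_ne_top, (hg x r hr).eLpNorm_ne_top⟩) ?_
  exact eLpNorm_add_le (hf x r hr).1 (hg x r hr).1 (by simpa using hp)

lemma ML.add {n : ℕ} {p : ℝ} {f g : EuclideanSpace ℝ (Fin n) → ℝ} (hf : ML p f)
    (hg : ML p g) : ML p (fun y => f y + g y) :=
  fun x r hr => (hf x r hr).add (hg x r hr)

lemma ML.const_mul {n : ℕ} {p : ℝ} {f : EuclideanSpace ℝ (Fin n) → ℝ} (hf : ML p f) (c : ℝ) :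
    ML p (fun y => c * f y) :=
  fun x r hr => (hf x r hr).const_mul c

lemma NB_const_mul {n : ℕ} {p : ℝ} {f : EuclideanSpace ℝ (Fin n) → ℝ} (c : ℝ)
    (x : EuclideanSpace ℝ (Fin n)) {r : ℝ} :
    NB p (fun y => c * f y) x r = |c| * NB p f x r := by
  unfold NB
  have := eLpNorm_const_smul (μ := muB x r) (p := ENNReal.ofReal p) c f
  have h2 : (c • f) = fun y => c * f y := rfl
  rw [← h2, this]
  simp

lemma NB_const {n : ℕ} {p : ℝ} (hp : 1 ≤ p) (c : ℝ)
    (x : EuclideanSpace ℝ (Fin n)) {r : ℝ} (hr : 0 < r) :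
    NB p (fun _ => c) x r = |c| := by
  have := muB_prob x hr
  unfold NB
  rw [eLpNorm_const _ (by simp; linarith) (IsProbabilityMeasure.ne_zero _)]
  simp

lemma ML_const {n : ℕ} {p : ℝ} (c : ℝ) : ML (n := n) p (fun _ => c) := by
  intro x r hr
  have := muB_prob x hr
  exact memLp_const c

lemma ML.integrable {n : ℕ} {p : ℝ} (hp : 1 ≤ p) {f : EuclideanSpace ℝ (Fin n) → ℝ}
    (hf : ML p f) (x : EuclideanSpace ℝ (Fin n)) {r : ℝ} (hr : 0 < r) :
    Integrable f (muB x r) := by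
  have := muB_prob x hr
  exact (hf x r hr).integrable (by simpa using hp)

lemma avg_le_NB {n : ℕ} {p : ℝ} (hp : 1 ≤ p) {f : EuclideanSpace ℝ (Fin n) → ℝ}
    (hf : ML p f) (x : EuclideanSpace ℝ (Fin n)) {r : ℝ} (hr : 0 < r) :
    |ballAvg f x r| ≤ NB p f x r := by
  have := muB_prob x hr
  have h : ‖∫ y, f y ∂(muB x r)‖ₑ ≤ eLpNorm f (ENNReal.ofReal p) (muB x r) := by
    refine (enorm_integral_le_lintegral_enorm _).trans ?_
    rw [← eLpNorm_one_eq_lintegral_enorm]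
    exact eLpNorm_le_eLpNorm_of_exponent_le (by simpa using hp) (hf x r hr).1
  rw [ballAvg_eq]
  have := ENNReal.toReal_mono (hf x r hr).eLpNorm_ne_top h
  simpa [NB] using this

lemma avg_sub_const {n : ℕ} {p : ℝ} (hp : 1 ≤ p) {f : EuclideanSpace ℝ (Fin n) → ℝ}
    (hf : ML p f) (x : EuclideanSpace ℝ (Fin n)) {r : ℝ} (hr : 0 < r) (c : ℝ) :
    ballAvg (fun y => f y - c) x r = ballAvg f x r - c := by
  have := muB_prob x hr
  rw [ballAvg_eq, ballAvg_eq, integral_sub (hf.integrable hp x hr) (integrable_const c)]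
  simp

/-- oscillation -/
def osc {n : ℕ} (p : ℝ) (f : EuclideanSpace ℝ (Fin n) → ℝ) (x : EuclideanSpace ℝ (Fin n))
    (r : ℝ) : ℝ := NB p (fun y => f y - ballAvg f x r) x r

lemma osc_le {n : ℕ} {p : ℝ} (hp : 1 ≤ p) {f : EuclideanSpace ℝ (Fin n) → ℝ}
    (hf : ML p f) (x : EuclideanSpace ℝ (Fin n)) {r : ℝ} (hr : 0 < r) (c : ℝ) :
    osc p f x r ≤ 2 * NB p (fun y => f y - c) x r := by
  have h1 := NB_add hp (hf.sub_const c) (ML_const (c - ballAvg f x r)) x hr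
  have h2 := avg_le_NB hp (hf.sub_const c) x hr
  rw [avg_sub_const hp hf x hr] at h2
  rw [NB_const hp _ x hr, abs_sub_comm] at h1
  simp only [sub_add_sub_cancel] at h1
  unfold osc
  linarith

lemma muB_le {n : ℕ} {x y : EuclideanSpace ℝ (Fin n)} {r s : ℝ} (hr : 0 < r) (hs : 0 < s)
    (hsub : ball x r ⊆ ball y s) (hK : s ≤ 4 * r) :
    muB x r ≤ ENNReal.ofReal (4 ^ n) • muB y s := by
  have hv : volume (ball y s) ≤ ENNReal.ofReal (4 ^ n) * volume (ball x r) := by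
    rw [Measure.addHaar_ball_of_pos _ _ hs, Measure.addHaar_ball_of_pos _ _ hr, ← mul_assoc,
      ← ENNReal.ofReal_mul (by positivity)]
    gcongr
    simp only [finrank_euclideanSpace, Fintype.card_fin]
    rw [← mul_pow]
    gcongr
  have hi : (volume (ball x r))⁻¹ ≤ ENNReal.ofReal (4 ^ n) * (volume (ball y s))⁻¹ := by
    rw [← div_eq_mul_inv, ENNReal.le_div_iff_mul_le (Or.inl (vol_pos y hs)) (Or.inl (vol_top y s)),
      mul_comm, ← div_eq_mul_inv]
    exact ENNReal.div_le_of_le_mul hv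
  unfold muB
  rw [smul_smul]
  intro t
  simp only [Measure.smul_apply, smul_eq_mul]
  gcongr

lemma NB_ball {n : ℕ} {p : ℝ} (hp : 1 ≤ p) {h : EuclideanSpace ℝ (Fin n) → ℝ}
    (hh : ML p h) {x y : EuclideanSpace ℝ (Fin n)} {r s : ℝ} (hr : 0 < r) (hs : 0 < s)
    (hsub : ball x r ⊆ ball y s) (hK : s ≤ 4 * r) :
    NB p h x r ≤ 4 ^ n * NB p h y s := by
  have h1 := eLpNorm_mono_measure (p := ENNReal.ofReal p) h (muB_le hr hs hsub hK)
  rw [eLpNorm_smul_measure_of_ne_top (by simp)] at h1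
  have h2 : ENNReal.ofReal (4 ^ n) ^ (1 / ENNReal.ofReal p).toReal ≤ ENNReal.ofReal (4 ^ n) := by
    conv_rhs => rw [← ENNReal.rpow_one (ENNReal.ofReal (4 ^ n))]
    apply ENNReal.rpow_le_rpow_of_exponent_le
    · rw [ENNReal.one_le_ofReal]; exact one_le_pow₀ (by norm_num)
    · rw [ENNReal.toReal_div, ENNReal.toReal_ofReal (by linarith)]
      simp only [ENNReal.toReal_one]
      rw [div_le_one (by linarith)]; exact hp
  have h3 : eLpNorm h (ENNReal.ofReal p) (muB x r)
      ≤ ENNReal.ofReal (4 ^ n) * eLpNorm h (ENNReal.ofReal p) (muB y s) := by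
    refine h1.trans ?_
    rw [smul_eq_mul]
    gcongr
  have h4 := ENNReal.toReal_mono
    (ENNReal.mul_ne_top ENNReal.ofReal_ne_top (hh y s hs).eLpNorm_ne_top) h3
  rw [ENNReal.toReal_mul, ENNReal.toReal_ofReal (by positivity)] at h4
  exact h4

lemma avg_diff {n : ℕ} {p : ℝ} (hp : 1 ≤ p) {f : EuclideanSpace ℝ (Fin n) → ℝ}
    (hf : ML p f) {x y : EuclideanSpace ℝ (Fin n)} {r s : ℝ} (hr : 0 < r) (hs : 0 < s)
    (hsub : ball x r ⊆ ball y s) (hK : s ≤ 4 * r) :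
    |ballAvg f x r - ballAvg f y s| ≤ 4 ^ n * osc p f y s := by
  rw [← avg_sub_const hp hf x hr]
  exact (avg_le_NB hp (hf.sub_const _) x hr).trans (NB_ball hp (hf.sub_const _) hr hs hsub hK)

lemma osc_ball {n : ℕ} {p : ℝ} (hp : 1 ≤ p) {f : EuclideanSpace ℝ (Fin n) → ℝ}
    (hf : ML p f) {x y : EuclideanSpace ℝ (Fin n)} {r s : ℝ} (hr : 0 < r) (hs : 0 < s)
    (hsub : ball x r ⊆ ball y s) (hK : s ≤ 4 * r) :
    osc p f x r ≤ 2 * 4 ^ n * osc p f y s := by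
  have h1 := osc_le hp hf x hr (ballAvg f y s)
  have h2 := NB_ball hp (hf.sub_const (ballAvg f y s)) hr hs hsub hK
  unfold osc at *
  linarith

lemma osc_eq {n : ℕ} {p : ℝ} (hp : 1 ≤ p) {f : EuclideanSpace ℝ (Fin n) → ℝ}
    (hf : ML p f) (x : EuclideanSpace ℝ (Fin n)) {r : ℝ} (hr : 0 < r) :
    ((volume (ball x r)).toReal⁻¹ * ∫ y in ball x r, |f y - ballAvg f x r| ^ p) ^ (1 / p)
      = osc p f x r := by
  unfold osc NB
  rw [MemLp.eLpNorm_eq_integral_rpow_norm (by simp; linarith) (by simp)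
    (hf.sub_const _ x r hr), ENNReal.toReal_ofReal (by positivity),
    ENNReal.toReal_ofReal (by linarith)]
  unfold muB
  rw [integral_smul_measure]
  simp [ENNReal.toReal_inv]

lemma osc_le_camp {n : ℕ} {p : ℝ} (hp : 1 ≤ p) {f : EuclideanSpace ℝ (Fin n) → ℝ}
    (hf : ML p f) {φ : EuclideanSpace ℝ (Fin n) → ℝ → ℝ} (hpos : GrowthPos φ)
    (hfin : campNorm p φ f < ⊤)
    (x : EuclideanSpace ℝ (Fin n)) {r : ℝ} (hr : 0 < r) :
    osc p f x r ≤ φ x r * (campNorm p φ f).toReal := by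
  have h1 : ENNReal.ofReal ((φ x r)⁻¹ * osc p f x r) ≤ campNorm p φ f := by
    refine le_trans ?_ (le_self_add : campSemi p φ f ≤ campNorm p φ f)
    rw [← osc_eq hp hf x hr]
    unfold campSemi
    exact le_iSup₂_of_le x r (le_iSup_of_le hr le_rfl)
  have h2 := (ENNReal.ofReal_le_iff_le_toReal hfin.ne).1 h1
  have h3 := hpos x r hr
  rwa [inv_mul_le_iff₀ h3] at h2

lemma avg_le_camp {n : ℕ} {p : ℝ} {f : EuclideanSpace ℝ (Fin n) → ℝ}
    {φ : EuclideanSpace ℝ (Fin n) → ℝ → ℝ}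
    (hfin : campNorm p φ f < ⊤) :
    |ballAvg f 0 1| ≤ (campNorm p φ f).toReal := by
  have h1 : ENNReal.ofReal |ballAvg f 0 1| ≤ campNorm p φ f := le_add_self
  exact (ENNReal.ofReal_le_iff_le_toReal hfin.ne).1 h1

lemma NB_mul {n : ℕ} {p₁ p₂ p₄ : ℝ}
    (hp₂ : 1 ≤ p₂) (hp₁ : p₂ < p₁) (hp₄ : p₁ * p₂ / (p₁ - p₂) ≤ p₄)
    {f g : EuclideanSpace ℝ (Fin n) → ℝ} (hf : ML p₁ f) (hg : ML p₄ g) :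
    ML p₂ (fun y => f y * g y) ∧ ∀ (x : EuclideanSpace ℝ (Fin n)) (r : ℝ), 0 < r →
      NB p₂ (fun y => f y * g y) x r ≤ NB p₁ f x r * NB p₄ g x r := by
  have h3 : 0 < p₁ * p₂ / (p₁ - p₂) := by
    apply div_pos <;> nlinarith
  have : ENNReal.HolderTriple (ENNReal.ofReal p₁) (ENNReal.ofReal (p₁ * p₂ / (p₁ - p₂)))
      (ENNReal.ofReal p₂) := by
    constructor
    rw [← ENNReal.ofReal_inv_of_pos (by linarith), ← ENNReal.ofReal_inv_of_pos h3,
      ← ENNReal.ofReal_inv_of_pos (by linarith),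
      ← ENNReal.ofReal_add (by rw [inv_nonneg]; linarith) (by positivity)]
    congr 1
    have : p₁ - p₂ ≠ 0 := by linarith
    have : p₁ ≠ 0 := by linarith
    have : p₂ ≠ 0 := by linarith
    field_simp
    ring
  refine ⟨fun x r hr => (hg.mono hp₄ x r hr).mul (hf x r hr), fun x r hr => ?_⟩
  have h4 := eLpNorm_smul_le_mul_eLpNorm (r := ENNReal.ofReal p₂) (hg.mono hp₄ x r hr).1
    (hf x r hr).1 (p := ENNReal.ofReal p₁) (q := ENNReal.ofReal (p₁ * p₂ / (p₁ - p₂)))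
  have h5 := ENNReal.toReal_mono (ENNReal.mul_ne_top (hf x r hr).eLpNorm_ne_top
    (hg.mono hp₄ x r hr).eLpNorm_ne_top) h4
  rw [ENNReal.toReal_mul] at h5
  refine le_trans h5 ?_
  exact mul_le_mul_of_nonneg_left (NB_mono hg hp₄ x hr) (NB_nonneg _ _ _ _)

/-- one-dimensional doubling data -/
structure DU (A : ℝ) (u : ℝ → ℝ) : Prop where
  one : 1 ≤ A
  meas : Measurable u
  pos : ∀ t, 0 < t → 0 < u t
  dbl : ∀ r s, 0 < r → r ≤ 2 * s → s ≤ 2 * r → u s ≤ A * u r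

lemma DU.step {A : ℝ} {u : ℝ → ℝ} (h : DU A u) {a b : ℝ} (ha : 0 < a) (hab : a ≤ b)
    (hb : b ≤ 2 * a) : IntervalIntegrable (fun t => u t / t) volume a b := by
  rw [intervalIntegrable_iff_integrableOn_Ioc_of_le hab]
  refine Measure.integrableOn_of_bounded (M := A * u a / a) (by simp)
    (h.meas.div measurable_id).aestronglyMeasurable ?_
  refine (ae_restrict_iff' measurableSet_Ioc).2 (ae_of_all _ fun t ht => ?_)
  have ht0 : 0 < t := ha.trans ht.1
  have h1 := h.pos t ht0
  rw [Real.norm_of_nonneg (by positivity)]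
  have h2 := h.dbl a t ha (by linarith [ht.1]) (by linarith [ht.2])
  have := h.pos a ha
  have := h.one
  exact div_le_div₀ (by positivity) h2 ha ht.1.le

lemma DU.pow {A : ℝ} {u : ℝ → ℝ} (h : DU A u) {a : ℝ} (ha : 0 < a) (k : ℕ) :
    IntervalIntegrable (fun t => u t / t) volume a (2 ^ k * a) := by
  induction k with
  | zero => simp
  | succ k ih =>
    refine ih.trans (h.step (by positivity) ?_ ?_)
    · rw [pow_succ]; nlinarith [show 0 < 2 ^ k * a by positivity]
    · rw [pow_succ]; linarith

lemma DU.int {A : ℝ} {u : ℝ → ℝ} (h : DU A u) {a b : ℝ} (ha : 0 < a) (hab : a ≤ b) :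
    IntervalIntegrable (fun t => u t / t) volume a b := by
  obtain ⟨k, hk⟩ := pow_unbounded_of_one_lt (b / a) (one_lt_two (α := ℝ))
  rw [div_lt_iff₀ ha] at hk
  refine (h.pow ha k).mono_set ?_
  rw [Set.uIcc_of_le hab, Set.uIcc_of_le (by linarith)]
  exact Set.Icc_subset_Icc le_rfl hk.le

lemma DU.nonneg {A : ℝ} {u : ℝ → ℝ} (h : DU A u) {a b : ℝ} (ha : 0 < a) (hab : a ≤ b) :
    0 ≤ ∫ t in a..b, u t / t := by
  refine intervalIntegral.integral_nonneg hab fun t ht => ?_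
  have ht0 : 0 < t := ha.trans_le ht.1
  exact (div_pos (h.pos t ht0) ht0).le

lemma DU.sub {A : ℝ} {u : ℝ → ℝ} (h : DU A u) {a b c d : ℝ} (ha : 0 < a) (hab : a ≤ b)
    (hbc : b ≤ c) (hcd : c ≤ d) :
    ∫ t in b..c, u t / t ≤ ∫ t in a..d, u t / t := by
  have hb : 0 < b := ha.trans_le hab
  have hc : 0 < c := hb.trans_le hbc
  have e1 := intervalIntegral.integral_add_adjacent_intervals (h.int ha hab) (h.int hb hbc)
  have e2 := intervalIntegral.integral_add_adjacent_intervals (h.int ha (hab.trans hbc))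
    (h.int hc hcd)
  have := h.nonneg ha hab
  have := h.nonneg hc hcd
  linarith

lemma DU.low {A : ℝ} {u : ℝ → ℝ} (h : DU A u) {r : ℝ} (hr : 0 < r) :
    u r ≤ 2 * A * ∫ t in r..2 * r, u t / t := by
  have hA : 0 < A := by linarith [h.one]
  have h1 : ∫ _ in r..2 * r, u r / (2 * A * r) ≤ ∫ t in r..2 * r, u t / t := by
    refine intervalIntegral.integral_mono_on (by linarith) (by simp) (h.int hr (by linarith)) ?_
    intro t ht
    have ht0 : 0 < t := hr.trans_le ht.1
    have h2 := h.dbl t r ht0 ht.2 (by linarith [ht.1])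
    rw [div_le_div_iff₀ (by positivity) ht0]
    have := h.pos r hr
    have := h.pos t ht0
    calc u r * t ≤ (A * u t) * (2 * r) := by
          apply mul_le_mul h2 ht.2 ht0.le (by positivity)
      _ = _ := by ring
  rw [intervalIntegral.integral_const, smul_eq_mul] at h1
  calc u r = 2 * A * ((2 * r - r) * (u r / (2 * A * r))) := by field_simp; ring
    _ ≤ _ := by gcongr

lemma DU.of {n : ℕ} {φ : EuclideanSpace ℝ (Fin n) → ℝ → ℝ} (hpos : GrowthPos φ)
    (hD : Doubling φ) (hm : ∀ x : EuclideanSpace ℝ (Fin n), Measurable fun t => φ x t) :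
    ∃ A, ∀ x, DU A (φ x) := by
  obtain ⟨A, hA, h⟩ := hD
  refine ⟨A, fun x => ⟨?_, hm x, hpos x, ?_⟩⟩
  · have := (h x 1 1 one_pos one_pos (by norm_num) (by norm_num)).2
    rwa [div_self (hpos x 1 one_pos).ne'] at this
  · intro r s hr h1 h2
    have hs : 0 < s := by linarith
    have := (h x r s hr hs (by rw [div_le_div_iff₀ (by norm_num) hr]; linarith)
      (by rw [div_le_iff₀ hr]; linarith)).2
    rwa [div_le_iff₀ (hpos x r hr)] at this

lemma chain {n : ℕ} {p : ℝ} (hp : 1 ≤ p) {f : EuclideanSpace ℝ (Fin n) → ℝ}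
    (hf : ML p f) {φ : EuclideanSpace ℝ (Fin n) → ℝ → ℝ} {A F : ℝ} (hF : 0 ≤ F)
    (hφ : ∀ x, DU A (φ x))
    (ho : ∀ x r, 0 < r → osc p f x r ≤ φ x r * F)
    (x : EuclideanSpace ℝ (Fin n)) {r : ℝ} (hr : 0 < r) (k : ℕ) :
    |ballAvg f x r - ballAvg f x (2 ^ k * r)|
      ≤ 4 ^ n * (2 * A ^ 2) * F * ∫ t in r..2 ^ k * r, φ x t / t := by
  induction k with
  | zero => simp
  | succ k ih =>
    set s := 2 ^ k * r with hs
    have hs0 : 0 < s := by positivity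
    have e : (2 : ℝ) ^ (k + 1) * r = 2 * s := by rw [hs, pow_succ]; ring
    rw [e]
    have hrs : r ≤ s := by
      rw [hs]; nlinarith [one_le_pow₀ (one_le_two (α := ℝ)) (n := k)]
    have hA : 1 ≤ A := (hφ x).one
    have h1 := avg_diff hp hf (x := x) (y := x) hs0 (by positivity : 0 < 2 * s)
      (ball_subset_ball (by linarith)) (by linarith)
    have h2 := ho x (2 * s) (by positivity)
    have h3 := (hφ x).dbl s (2 * s) hs0 (by linarith) le_rfl
    have h4 := (hφ x).low hs0
    rw [← intervalIntegral.integral_add_adjacent_intervals ((hφ x).int hr hrs)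
      ((hφ x).int hs0 (by linarith : s ≤ 2 * s))]
    set I := ∫ t in s..2 * s, φ x t / t
    have h5 : osc p f x (2 * s) ≤ 2 * A ^ 2 * F * I := by
      calc osc p f x (2 * s) ≤ φ x (2 * s) * F := h2
        _ ≤ (A * (2 * A * I)) * F := by gcongr; exact h3.trans (by gcongr)
        _ = _ := by ring
    have h6 : (4 : ℝ) ^ n * osc p f x (2 * s) ≤ 4 ^ n * (2 * A ^ 2 * F * I) := by gcongr
    have h7 := abs_sub_le (ballAvg f x r) (ballAvg f x s) (ballAvg f x (2 * s))
    linarith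

lemma top_bd {n : ℕ} {φ : EuclideanSpace ℝ (Fin n) → ℝ → ℝ} {A : ℝ}
    (hφ : ∀ x, DU A (φ x)) {M : ℝ} (hM : 2 ≤ M) :
    φ 0 (2 * M) ≤ 2 * A ^ 3 * ∫ t in (1 : ℝ)..M, φ 0 t / t := by
  have h := hφ 0
  have hA := h.one
  have h1 := h.dbl M (2 * M) (by linarith) (by linarith) (by linarith)
  have h2 := h.dbl (M / 2) M (by linarith) (by linarith) (by linarith)
  have h3 := h.low (r := M / 2) (by linarith)
  have h4 := h.sub one_pos (show 1 ≤ M / 2 by linarith) (show M / 2 ≤ 2 * (M / 2) by linarith)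
    (show 2 * (M / 2) ≤ M by linarith)
  calc φ 0 (2 * M) ≤ A * (A * (2 * A * ∫ t in (M / 2)..(2 * (M / 2)), φ 0 t / t)) := by
        refine h1.trans ?_
        gcongr
        refine h2.trans ?_
        gcongr
    _ ≤ A * (A * (2 * A * ∫ t in (1 : ℝ)..M, φ 0 t / t)) := by gcongr
    _ = _ := by ring

lemma avg_bd {n : ℕ} {p : ℝ} (hp : 1 ≤ p) {f : EuclideanSpace ℝ (Fin n) → ℝ}
    (hf : ML p f) {φ : EuclideanSpace ℝ (Fin n) → ℝ → ℝ} {A F : ℝ} (hF : 0 ≤ F)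
    (hφ : ∀ x, DU A (φ x))
    (ho : ∀ x r, 0 < r → osc p f x r ≤ φ x r * F) (h01 : |ballAvg f 0 1| ≤ F)
    (x : EuclideanSpace ℝ (Fin n)) {r : ℝ} (hr : 0 < r) :
    |ballAvg f x r| ≤ (2 * A / φ 0 1 + 4 ^ n * (2 * A ^ 2) + 4 ^ n * (4 * A ^ 3)) *
      F * (PhiStar φ x r + PhiStarStar φ x r) := by
  unfold PhiStar PhiStarStar
  set M := max 2 (max ‖x‖ r) with hM
  have hM2 : 2 ≤ M := le_max_left _ _
  have hMx : ‖x‖ ≤ M := (le_max_left _ _).trans (le_max_right _ _)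
  have hMr : r ≤ M := (le_max_right _ _).trans (le_max_right _ _)
  have hA := (hφ 0).one
  have hφ1 := (hφ 0).pos 1 one_pos
  obtain ⟨k, hk1, hk2⟩ := exists_nat_pow_near (show 1 ≤ M by linarith) (one_lt_two (α := ℝ))
  obtain ⟨j, hj1, hj2⟩ := exists_nat_pow_near (show 1 ≤ M / r by rwa [one_le_div hr])
    (one_lt_two (α := ℝ))
  rw [le_div_iff₀ hr] at hj1
  rw [div_lt_iff₀ hr, pow_succ] at hj2
  rw [pow_succ] at hk2
  have hk0 : (1 : ℝ) ≤ 2 ^ k := one_le_pow₀ one_le_two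
  have hj0 : (1 : ℝ) ≤ 2 ^ j := one_le_pow₀ one_le_two
  have c1 := chain hp hf hF hφ ho 0 one_pos k
  have c2 := chain hp hf hF hφ ho x hr j
  rw [mul_one] at c1
  have s1 := (hφ 0).sub one_pos le_rfl hk0 hk1
  have s2 := (hφ x).sub hr le_rfl (by nlinarith : r ≤ 2 ^ j * r) hj1
  have d1 := avg_diff hp hf (x := 0) (y := 0) (by positivity : (0 : ℝ) < 2 ^ k)
    (by linarith : 0 < 2 * M) (ball_subset_ball (by linarith)) (by linarith)
  have hsub : ball x (2 ^ j * r) ⊆ ball (0 : EuclideanSpace ℝ (Fin n)) (2 * M) := by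
    apply ball_subset_ball'
    rw [dist_zero_right]; linarith
  have d2 := avg_diff hp hf (by positivity : 0 < 2 ^ j * r)
    (by linarith : 0 < 2 * M) hsub (by linarith)
  have t1 := top_bd hφ hM2
  have o1 := ho 0 (2 * M) (by linarith)
  have l1 := (hφ 0).low one_pos
  have l2 := (hφ 0).sub one_pos le_rfl (by norm_num : (1 : ℝ) ≤ 2 * 1)
    (by linarith : 2 * 1 ≤ M)
  have n1 := (hφ 0).nonneg one_pos (by linarith : 1 ≤ M)
  have n2 := (hφ x).nonneg hr hMr
  set P := ∫ t in (1 : ℝ)..M, φ 0 t / t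
  set Q := ∫ t in r..M, φ x t / t
  have b0 : 1 ≤ 2 * A / φ 0 1 * P := by
    rw [div_mul_eq_mul_div, one_le_div hφ1]
    exact l1.trans (by gcongr)
  have b1 : F ≤ 2 * A / φ 0 1 * F * P := by nlinarith
  have b2 : 4 ^ n * osc p f 0 (2 * M) ≤ 4 ^ n * (2 * A ^ 3) * F * P := by
    calc 4 ^ n * osc p f 0 (2 * M) ≤ 4 ^ n * ((2 * A ^ 3 * P) * F) := by
          gcongr; exact o1.trans (by gcongr)
      _ = _ := by ring
  have b3 := c1.trans (mul_le_mul_of_nonneg_left s1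
    (by positivity : 0 ≤ 4 ^ n * (2 * A ^ 2) * F))
  have b4 := c2.trans (mul_le_mul_of_nonneg_left s2
    (by positivity : 0 ≤ 4 ^ n * (2 * A ^ 2) * F))
  have key : |ballAvg f x r| ≤ F + 4 ^ n * (2 * A ^ 2) * F * P
      + 2 * (4 ^ n * (2 * A ^ 3) * F * P) + 4 ^ n * (2 * A ^ 2) * F * Q := by
    rw [abs_le] at *
    constructor <;> linarith [b3.1, b3.2, b4.1, b4.2, d1.1, d1.2, d2.1, d2.2, h01.1, h01.2]
  have z1 : 0 ≤ 2 * A / φ 0 1 * F * Q := by positivity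
  have z2 : 0 ≤ 4 ^ n * (4 * A ^ 3) * F * Q := by positivity
  linarith

lemma osc_bd {n : ℕ} {p : ℝ} (hp : 1 ≤ p) {f : EuclideanSpace ℝ (Fin n) → ℝ}
    (hf : ML p f) {φ : EuclideanSpace ℝ (Fin n) → ℝ → ℝ} {A F : ℝ} (hF : 0 ≤ F)
    (hφ : ∀ x, DU A (φ x))
    (ho : ∀ x r, 0 < r → osc p f x r ≤ φ x r * F)
    (x : EuclideanSpace ℝ (Fin n)) {r : ℝ} (hr : 0 < r) :
    osc p f x r ≤ (4 ^ n * (4 * A ^ 3) + 2 * A) *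
      F * (PhiStar φ x r + PhiStarStar φ x r) := by
  unfold PhiStar PhiStarStar
  set M := max 2 (max ‖x‖ r) with hM
  have hM2 : 2 ≤ M := le_max_left _ _
  have hMx : ‖x‖ ≤ M := (le_max_left _ _).trans (le_max_right _ _)
  have hMr : r ≤ M := (le_max_right _ _).trans (le_max_right _ _)
  have hA := (hφ 0).one
  have n1 := (hφ 0).nonneg one_pos (by linarith : 1 ≤ M)
  have n2 := (hφ x).nonneg hr hMr
  have t1 := top_bd hφ hM2
  have h2 : 2 * r ≤ M → ∫ t in r..2 * r, φ x t / t ≤ ∫ t in r..M, φ x t / t :=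
    fun h => (hφ x).sub hr le_rfl (by linarith) h
  set P := ∫ t in (1 : ℝ)..M, φ 0 t / t
  set Q := ∫ t in r..M, φ x t / t
  have z1 : 0 ≤ 4 ^ n * (4 * A ^ 3) * F * Q := by positivity
  have z2 : 0 ≤ 4 ^ n * (4 * A ^ 3) * F * P := by positivity
  have z3 : 0 ≤ 2 * A * F * Q := by positivity
  have z4 : 0 ≤ 2 * A * F * P := by positivity
  rcases le_total (2 * r) M with h | h
  · have : osc p f x r ≤ 2 * A * F * Q := by
      calc osc p f x r ≤ φ x r * F := ho x r hr
        _ ≤ (2 * A * Q) * F := by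
          gcongr
          refine ((hφ x).low hr).trans ?_
          have := h2 h
          gcongr
        _ = _ := by ring
    linarith
  · have hsub : ball x r ⊆ ball (0 : EuclideanSpace ℝ (Fin n)) (2 * M) := by
      apply ball_subset_ball'
      rw [dist_zero_right]; linarith
    have d2 := osc_ball hp hf hr (by linarith : 0 < 2 * M) hsub (by linarith)
    have o1 := ho 0 (2 * M) (by linarith)
    have : osc p f x r ≤ 4 ^ n * (4 * A ^ 3) * F * P := by
      calc osc p f x r ≤ 2 * 4 ^ n * ((2 * A ^ 3 * P) * F) := by
            refine d2.trans ?_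
            gcongr
            exact o1.trans (by gcongr)
        _ = _ := by ring
    linarith

lemma Phi_pos {n : ℕ} {φ : EuclideanSpace ℝ (Fin n) → ℝ → ℝ} {A : ℝ}
    (hφ : ∀ x, DU A (φ x)) (x : EuclideanSpace ℝ (Fin n)) {r : ℝ} (hr : 0 < r) :
    0 < PhiStar φ x r + PhiStarStar φ x r := by
  unfold PhiStar PhiStarStar
  set M := max 2 (max ‖x‖ r) with hM
  have hM2 : 2 ≤ M := le_max_left _ _
  have hMr : r ≤ M := (le_max_right _ _).trans (le_max_right _ _)
  have hA := (hφ 0).one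
  have n2 := (hφ x).nonneg hr hMr
  have t1 := top_bd hφ hM2
  have t2 := (hφ 0).pos (2 * M) (by linarith)
  have : 0 < ∫ t in (1 : ℝ)..M, φ 0 t / t :=
    pos_of_mul_pos_right (t2.trans_le t1) (by positivity)
  linarith

/-- With `ψ = φ (Φ* + Φ**)`, every `g ∈ 𝓛𝓝_{p₄,φ}` is a pointwise
multiplier from `𝓛𝓝_{p₁,φ}` to `𝓛𝓝_{p₂,ψ}`, and
`‖fg‖_{𝓛𝓝_{p₂,ψ}} ≤ C ‖f‖_{𝓛𝓝_{p₁,φ}} ‖g‖_{𝓛𝓝_{p₄,φ}}`. -/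
theorem pointwise_multiplier_campanato' (n : ℕ) (p₁ p₂ p₄ : ℝ)
    (hp₂ : 1 ≤ p₂) (hp₁ : p₂ < p₁) (hp₄ : p₁ * p₂ / (p₁ - p₂) ≤ p₄)
    (φ : EuclideanSpace ℝ (Fin n) → ℝ → ℝ) (hpos : GrowthPos φ) (hD : Doubling φ)
    (hm : ∀ x : EuclideanSpace ℝ (Fin n), Measurable fun t => φ x t) :
    ∃ C > 0, ∀ f g : EuclideanSpace ℝ (Fin n) → ℝ,
      MemLpLoc p₁ f → MemLpLoc p₄ g →
      campNorm p₁ φ f < ⊤ → campNorm p₄ φ g < ⊤ →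
        campNorm p₂ (fun x r => φ x r * (PhiStar φ x r + PhiStarStar φ x r))
            (fun x => f x * g x) < ⊤ ∧
        campNorm p₂ (fun x r => φ x r * (PhiStar φ x r + PhiStarStar φ x r))
            (fun x => f x * g x) ≤
          ENNReal.ofReal C * (campNorm p₁ φ f * campNorm p₄ φ g) := by
  obtain ⟨A, hφ⟩ := DU.of hpos hD hm
  have hA := (hφ 0).one
  have hφ1 := (hφ 0).pos 1 one_pos
  set C₀ := 2 * A / φ 0 1 + 4 ^ n * (2 * A ^ 2) + 4 ^ n * (4 * A ^ 3) with hC₀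
  set C₁ := 4 ^ n * (4 * A ^ 3) + 2 * A with hC₁
  have hC₀p : 0 < C₀ := by positivity
  have hC₁p : 0 < C₁ := by positivity
  refine ⟨2 * (C₁ + 2 * C₀) + (φ 0 1 + 1) ^ 2, by positivity, ?_⟩
  intro f g hf' hg' hfF hgF
  have h3 : p₂ ≤ p₁ * p₂ / (p₁ - p₂) := by
    rw [le_div_iff₀ (by linarith)]; nlinarith
  have hp1 : 1 ≤ p₁ := by linarith
  have hp4 : 1 ≤ p₄ := by linarith
  have hf := ML_of hp1 hf'
  have hg := ML_of hp4 hg'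
  have of := fun x r hr => osc_le_camp hp1 hf hpos hfF x (r := r) hr
  have og := fun x r hr => osc_le_camp hp4 hg hpos hgF x (r := r) hr
  have af := avg_le_camp hfF
  have ag := avg_le_camp hgF
  have eFG : campNorm p₁ φ f * campNorm p₄ φ g
      = ENNReal.ofReal ((campNorm p₁ φ f).toReal * (campNorm p₄ φ g).toReal) := by
    rw [ENNReal.ofReal_mul ENNReal.toReal_nonneg, ENNReal.ofReal_toReal hfF.ne,
      ENNReal.ofReal_toReal hgF.ne]
  rw [eFG]
  generalize (campNorm p₁ φ f).toReal = F at *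
  generalize (campNorm p₄ φ g).toReal = G at *
  have hF : 0 ≤ F := (abs_nonneg _).trans af
  have hG : 0 ≤ G := (abs_nonneg _).trans ag
  have hfg := NB_mul hp₂ hp₁ hp₄ hf hg
  suffices hmain : campNorm p₂ (fun x r => φ x r * (PhiStar φ x r + PhiStarStar φ x r))
      (fun x => f x * g x) ≤
        ENNReal.ofReal (2 * (C₁ + 2 * C₀) + (φ 0 1 + 1) ^ 2) * ENNReal.ofReal (F * G) from
    ⟨hmain.trans_lt (ENNReal.mul_lt_top ENNReal.ofReal_lt_top ENNReal.ofReal_lt_top), hmain⟩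
  rw [← ENNReal.ofReal_mul (by positivity), add_mul,
    ENNReal.ofReal_add (by positivity) (by positivity)]
  unfold campNorm
  refine add_le_add ?_ (ENNReal.ofReal_le_ofReal ?_)
  · unfold campSemi
    refine iSup₂_le fun x r => iSup_le fun hr => ENNReal.ofReal_le_ofReal ?_
    rw [osc_eq hp₂ hfg.1 x hr]
    have hΦ := Phi_pos hφ x hr
    have hφx := (hφ x).pos r hr
    have bf := avg_bd hp1 hf hF hφ of af x hr
    have bg := avg_bd hp4 hg hG hφ og ag x hr
    have bo := osc_bd hp4 hg hG hφ og x hr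
    have o1 := of x r hr
    have o2 := og x r hr
    rw [← hC₀] at bf bg
    rw [← hC₁] at bo
    rw [inv_mul_le_iff₀ (by positivity)]
    beta_reduce
    generalize PhiStar φ x r + PhiStarStar φ x r = Φ at *
    have k1 := osc_le hp₂ hfg.1 x hr (ballAvg f x r * ballAvg g x r)
    have mf := hf.sub_const (ballAvg f x r)
    have mg := hg.sub_const (ballAvg g x r)
    have hm2 := NB_mul hp₂ hp₁ hp₄ mf mg
    have mf2 := mf.mono hp₁.le
    have mg2 := mg.mono (show p₂ ≤ p₄ by linarith)
    have e : (fun y => f y * g y - ballAvg f x r * ballAvg g x r) = fun y =>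
        (f y - ballAvg f x r) * (g y - ballAvg g x r) +
        (ballAvg f x r * (g y - ballAvg g x r) + ballAvg g x r * (f y - ballAvg f x r)) := by
      funext y; ring
    rw [e] at k1
    have k2 := NB_add hp₂ hm2.1 ((mg2.const_mul (ballAvg f x r)).add
      (mf2.const_mul (ballAvg g x r))) x hr
    have k3 := NB_add hp₂ (mg2.const_mul (ballAvg f x r)) (mf2.const_mul (ballAvg g x r)) x hr
    rw [NB_const_mul, NB_const_mul] at k3
    have k4 := hm2.2 x r hr
    have k5 := NB_mono mf hp₁.le x hr
    have k6 := NB_mono mg (show p₂ ≤ p₄ by linarith) x hr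
    have u1 : NB p₁ (fun y => f y - ballAvg f x r) x r * NB p₄ (fun y => g y - ballAvg g x r) x r
        ≤ (φ x r * F) * (C₁ * G * Φ) :=
      mul_le_mul o1 bo (NB_nonneg _ _ _ _) (by positivity)
    have u2 : |ballAvg f x r| * NB p₂ (fun y => g y - ballAvg g x r) x r
        ≤ (C₀ * F * Φ) * (φ x r * G) :=
      mul_le_mul bf (k6.trans o2) (NB_nonneg _ _ _ _) (by positivity)
    have u3 : |ballAvg g x r| * NB p₂ (fun y => f y - ballAvg f x r) x r
        ≤ (C₀ * G * Φ) * (φ x r * F) :=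
      mul_le_mul bg (k5.trans o1) (NB_nonneg _ _ _ _) (by positivity)
    calc _ ≤ 2 * ((φ x r * F) * (C₁ * G * Φ) + ((C₀ * F * Φ) * (φ x r * G)
          + (C₀ * G * Φ) * (φ x r * F))) := by linarith
      _ = _ := by ring
  · have q1 := avg_le_NB hp₂ hfg.1 0 one_pos
    have q2 := hfg.2 0 1 one_pos
    have r1 : NB p₁ f 0 1 ≤ (φ 0 1 + 1) * F := by
      have := NB_add hp1 (hf.sub_const (ballAvg f 0 1)) (ML_const (ballAvg f 0 1)) 0 one_pos
      rw [NB_const hp1 _ _ one_pos] at this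
      simp only [sub_add_cancel] at this
      have o := of 0 1 one_pos
      unfold osc at o
      linarith
    have r2 : NB p₄ g 0 1 ≤ (φ 0 1 + 1) * G := by
      have := NB_add hp4 (hg.sub_const (ballAvg g 0 1)) (ML_const (ballAvg g 0 1)) 0 one_pos
      rw [NB_const hp4 _ _ one_pos] at this
      simp only [sub_add_cancel] at this
      have o := og 0 1 one_pos
      unfold osc at o
      linarith
    calc _ ≤ NB p₁ f 0 1 * NB p₄ g 0 1 := q1.trans q2
      _ ≤ ((φ 0 1 + 1) * F) * ((φ 0 1 + 1) * G) :=
        mul_le_mul r1 r2 (NB_nonneg _ _ _ _) (by positivity)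
      _ = _ := by ring

end
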